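/- Let α, β, μ, ν be real, let s ∈ ℂ with Re s > 2, let z = iτ with Re τ > 0 and |arg τ| < π/2, and let u be a real constant with 1 − Re s < u < −1. Then F_{ℤ²}(s;α,β;μ,ν;z) = δ(β)·𝒜(s,α,μ) + Σ₋(s;z) + Σ₊(s;z), where for each sign ± the quantity Σ_±(s;z) := (1/2π)·∫_{−∞}^{∞} (Γ(s+w)Γ(−w)/Γ(s))·ψ_ℤ^±(s+w,α,μ)·ψ(−w,±β,±ν)·(e^{±πi/2}τ)^w dv evaluated at w = u + iv (so dw = i·dv), plus δ(α)·ψ(s,±β,±ν)·(e^{±πi/2}τ)^{−s}; here the powers (e^{±πi/2}τ)^w and (e^{±πi/2}τ)^{−s} use the principal logarithm, and the integrals converge absolutely. -/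

import Mathlib

noncomputable section

open Complex MeasureTheory
open scoped Real Classical

/-- `e(s) = exp(2 π i s)`. -/
def ee (s : ℂ) : ℂ := Complex.exp (2 * (Real.pi : ℂ) * Complex.I * s)

/-- `δ(x) = 1` if `x ∈ ℤ`, `0` otherwise. -/
def dInt (x : ℝ) : ℂ := if ∃ n : ℤ, (n : ℝ) = x then 1 else 0

/-- The Lerch zeta function `ψ(r,γ,κ) = Σ_{k ∈ ℤ, γ+k>0} e((γ+k)κ) (γ+k)^{-r}`
(a convergent series when `Re r > 1`). -/
def psiL (r : ℂ) (γ κ : ℝ) : ℂ :=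
  ∑' k : {k : ℤ // 0 < γ + (k : ℝ)},
    ee ((((γ + (k.1 : ℝ)) * κ : ℝ)) : ℂ) * (((γ + (k.1 : ℝ)) : ℝ) : ℂ) ^ (-r)

/-- The `q`-series `𝒮_r(γ,δ;κ,λ;q)`, where `q = e^{-2πt}` with `Re t > 0`, and the power
`q^{(γ+k)(δ+l)}` is interpreted as `exp (-2πt(γ+k)(δ+l))`. -/
def Scal (r : ℂ) (γ δ' κ lam : ℝ) (t : ℂ) : ℂ :=
  ∑' (k : {k : ℤ // 0 < γ + (k : ℝ)}) (l : {l : ℤ // 0 < δ' + (l : ℝ)}),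
    ee ((((γ + (k.1 : ℝ)) * κ + (δ' + (l.1 : ℝ)) * lam : ℝ)) : ℂ) *
      (((δ' + (l.1 : ℝ)) : ℝ) : ℂ) ^ (-r) *
      Complex.exp (-2 * (Real.pi : ℂ) * t * ((γ + (k.1 : ℝ) : ℝ) : ℂ) * ((δ' + (l.1 : ℝ) : ℝ) : ℂ))

/-- The generalized Eisenstein series `F_{ℤ²}(s;α,β;μ,ν;z)` (mean of the two branch
conventions), defined by an absolutely convergent series for `Re s > 2`. -/
def Fz2 (s : ℂ) (α β μ ν : ℝ) (z : ℂ) : ℂ :=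
  (∑' p : {p : ℤ × ℤ // β + (p.2 : ℝ) ≠ 0},
      ee ((((α + (p.1.1 : ℝ)) * μ + (β + (p.1.2 : ℝ)) * ν : ℝ)) : ℂ) *
        ((((α + (p.1.1 : ℝ)) : ℝ) : ℂ) + (((β + (p.1.2 : ℝ)) : ℝ) : ℂ) * z) ^ (-s)) +
  dInt β *
    ((∑' m : {m : ℤ // 0 < α + (m : ℝ)},
        ee ((((α + (m.1 : ℝ)) * μ : ℝ)) : ℂ) * (((α + (m.1 : ℝ)) : ℝ) : ℂ) ^ (-s)) +
      Complex.cos ((Real.pi : ℂ) * s) *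
        ∑' m : {m : ℤ // α + (m : ℝ) < 0},
          ee ((((α + (m.1 : ℝ)) * μ : ℝ)) : ℂ) * ((|α + (m.1 : ℝ)| : ℝ) : ℂ) ^ (-s))

/-- `𝒜(s,α,μ) = cos(πs) ψ(s,-α,-μ) + ψ(s,α,μ)`. -/
def Acal (s : ℂ) (α μ : ℝ) : ℂ :=
  Complex.cos ((Real.pi : ℂ) * s) * psiL s (-α) (-μ) + psiL s α μ

/-- `ψ(k,γ,κ)` at an integer `k`: the convergent series for `k ≥ 2`, the value
`-𝒞_{1-k}(⟨γ⟩,κ)/(1-k) - δ_{k0} δ(γ)` of the analytic continuation for `k ≤ 0`,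
and the (irrelevant) value `0` for `k = 1`; here `C` is the family of Taylor
coefficients `𝒞`. -/
def psiIntC (C : ℕ → ℂ → ℝ → ℂ) (k : ℤ) (γ κ : ℝ) : ℂ :=
  if 2 ≤ k then
    ∑' n : {n : ℤ // 0 < γ + (n : ℝ)},
      ee ((((γ + (n.1 : ℝ)) * κ : ℝ)) : ℂ) * (((γ + (n.1 : ℝ)) : ℝ) : ℂ) ^ (-k)
  else if k ≤ 0 then
    -C (1 - k).toNat ((Int.fract γ : ℝ) : ℂ) κ / ((1 : ℂ) - (k : ℂ)) -
      (if k = 0 then dInt γ else 0)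
  else 0

/-- The Bernoulli polynomial `B_j(x)` evaluated in `ℂ`. -/
def BpolyC (j : ℕ) (x : ℂ) : ℂ := Polynomial.aeval x (Polynomial.bernoulli j)

/-- Weierstrass `℘`-function with periods `(1, z)`. -/
def wpFn (z w : ℂ) : ℂ :=
  w ^ (-2 : ℤ) + ∑' p : {p : ℤ × ℤ // p ≠ (0, 0)},
    ((w - (p.1.1 : ℂ) - (p.1.2 : ℂ) * z) ^ (-2 : ℤ) -
      ((p.1.1 : ℂ) + (p.1.2 : ℂ) * z) ^ (-2 : ℤ))

/-- Weierstrass zeta function with periods `(1, z)`. -/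
def wzetaFn (z w : ℂ) : ℂ :=
  1 / w + ∑' p : {p : ℤ × ℤ // p ≠ (0, 0)},
    (1 / (w - (p.1.1 : ℂ) - (p.1.2 : ℂ) * z) + 1 / ((p.1.1 : ℂ) + (p.1.2 : ℂ) * z) +
      w / ((p.1.1 : ℂ) + (p.1.2 : ℂ) * z) ^ 2)

/-- Weierstrass sigma function with periods `(1, z)`. -/
def wsigmaFn (z w : ℂ) : ℂ :=
  w * ∏' p : {p : ℤ × ℤ // p ≠ (0, 0)},
    ((1 - w / ((p.1.1 : ℂ) + (p.1.2 : ℂ) * z)) *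
      Complex.exp (w / ((p.1.1 : ℂ) + (p.1.2 : ℂ) * z) +
        w ^ 2 / (2 * ((p.1.1 : ℂ) + (p.1.2 : ℂ) * z) ^ 2)))

/-- The `q`-Pochhammer symbol `(Z;q)_∞`. -/
def qPoch (Z q : ℂ) : ℂ := ∏' l : ℕ, (1 - Z * q ^ l)

/-- `⟨x⟩' = 1 - ⟨-x⟩`. -/
def fracP (x : ℝ) : ℝ := 1 - Int.fract (-x)

/-- The Eisenstein series `E₂`. -/
def E2cl (z : ℂ) : ℂ := 1 - 24 * ∑' l : ℕ+, (l : ℂ) * ee z ^ (l : ℕ) / (1 - ee z ^ (l : ℕ))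

/-- `a_{2k}`: `ζ(1-2k)` for `k ≠ 0` and `2ζ'(0) = -log 2π` for `k = 0`. -/
def acoef (k : ℤ) : ℂ :=
  if k = 0 then -(Real.log (2 * Real.pi) : ℂ) else riemannZeta ((1 - 2 * k : ℤ) : ℂ)

/-- The classical Eisenstein series `E_{2k}`. -/
def Ecl (k : ℤ) (z : ℂ) : ℂ :=
  1 + (2 / acoef k) * ∑' l : ℕ+, (l : ℂ) ^ (2 * k - 1) * ee z ^ (l : ℕ) / (1 - ee z ^ (l : ℕ))

/-- The bilateral Lerch zeta function `ψ_ℤ^ε(r,γ,κ) = e^{-επir} ψ(r,-γ,-κ) + ψ(r,γ,κ)`. -/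
def psiZpm (ε : ℤ) (r : ℂ) (γ κ : ℝ) : ℂ :=
  Complex.exp (-(ε : ℂ) * (Real.pi : ℂ) * Complex.I * r) * psiL r (-γ) (-κ) + psiL r γ κ

/-- The integrand of the Mellin–Barnes integral `Σ_ε(s;z)` (at `w = u + iv`). -/
def sigIntegrand (ε : ℤ) (s : ℂ) (α μ β ν u : ℝ) (τ : ℂ) (v : ℝ) : ℂ :=
  Complex.Gamma (s + ((u : ℂ) + Complex.I * (v : ℂ))) *
      Complex.Gamma (-((u : ℂ) + Complex.I * (v : ℂ))) / Complex.Gamma s *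
    psiZpm ε (s + ((u : ℂ) + Complex.I * (v : ℂ))) α μ *
    psiL (-((u : ℂ) + Complex.I * (v : ℂ))) ((ε : ℝ) * β) ((ε : ℝ) * ν) *
    (Complex.exp ((ε : ℂ) * (Real.pi : ℂ) * Complex.I / 2) * τ) ^ ((u : ℂ) + Complex.I * (v : ℂ))

/-- `Σ_ε(s;z)`: the Mellin–Barnes integral on the line `Re w = u` plus the extra term
`δ(α) ψ(s,εβ,εν) (e^{επi/2} τ)^{-s}`. -/
def SigPM (ε : ℤ) (s : ℂ) (α μ β ν u : ℝ) (τ : ℂ) : ℂ :=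
  ((1 / (2 * Real.pi) : ℝ) : ℂ) * (∫ v : ℝ, sigIntegrand ε s α μ β ν u τ v) +
    dInt α * psiL s ((ε : ℝ) * β) ((ε : ℝ) * ν) *
      (Complex.exp ((ε : ℂ) * (Real.pi : ℂ) * Complex.I / 2) * τ) ^ (-s)

lemma exists_pos_mul_le_norm_one_add_mul {z : ℂ} (hz : z ∈ slitPlane) :
    ∃ c > 0, ∀ x : ℝ, 0 ≤ x → c * (1 + x) ≤ ‖1 + x * z‖ := by
  obtain ⟨w, hw, hmin⟩ := (isCompact_Icc (a := (0 : ℝ)) (b := 1)).exists_isMinOn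
    (f := fun t : ℝ => ‖(1 : ℂ) + t • (z - 1)‖) (Set.nonempty_Icc.2 zero_le_one)
    (by fun_prop)
  have hne : (1 : ℂ) + w • (z - 1) ≠ 0 :=
    slitPlane_ne_zero (starConvex_one_slitPlane.add_smul_sub_mem hz hw.1 hw.2)
  refine ⟨_, norm_pos_iff.2 hne, fun x hx => ?_⟩
  have h1 : 0 < 1 + x := by linarith
  have h := hmin (show x / (1 + x) ∈ Set.Icc (0 : ℝ) 1 from
    ⟨by positivity, (div_le_one h1).2 (by linarith)⟩)
  have hx' : (1 : ℂ) + x ≠ 0 := by exact_mod_cast h1.ne'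
  have e : (1 : ℂ) + x * z = ((1 + x : ℝ) : ℂ) * (1 + (x / (1 + x)) • (z - 1)) := by
    simp only [real_smul]
    push_cast
    field_simp
    ring
  rw [e, norm_mul, norm_real, Real.norm_of_nonneg h1.le, mul_comm]
  exact mul_le_mul_of_nonneg_left h h1.le

lemma integrableOn_rpow_mul_one_add_rpow {p a : ℝ} (hp : 0 < p) (hpa : p < a) :
    IntegrableOn (fun x : ℝ => x ^ (p - 1) * (1 + x) ^ (-a)) (Set.Ioi 0) := by
  have hc : ContinuousOn (fun x : ℝ => (1 + x) ^ (-a)) (Set.Ici 0) := by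
    refine ContinuousOn.rpow_const (by fun_prop) fun x hx => Or.inl ?_
    have : (0 : ℝ) ≤ x := hx
    positivity
  refine mellin_convergent_of_isBigO_scalar (f := fun x : ℝ => (1 + x) ^ (-a)) (a := a) (b := 0)
    ((hc.mono Set.Ioi_subset_Ici_self).locallyIntegrableOn measurableSet_Ioi) ?_ hpa ?_ hp
  · refine Asymptotics.IsBigO.of_bound 1 ?_
    filter_upwards [Filter.eventually_gt_atTop 0] with x hx
    rw [one_mul, Real.norm_of_nonneg (by positivity), Real.norm_of_nonneg (by positivity)]
    exact Real.rpow_le_rpow_of_nonpos hx (by linarith) (by linarith)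
  · refine Asymptotics.IsBigO.of_bound 1 ?_
    filter_upwards [self_mem_nhdsWithin] with x hx
    have hx : (0 : ℝ) < x := hx
    rw [one_mul, Real.norm_of_nonneg (by positivity)]
    simp only [neg_zero, Real.rpow_zero, norm_one]
    exact Real.rpow_le_one_of_one_le_of_nonpos (by linarith) (by linarith)

lemma norm_cpow_neg_le_of_le_norm {w s : ℂ} {r : ℝ} (hr : 0 < r) (h : r ≤ ‖w‖) (hs : 0 ≤ s.re) :
    ‖w ^ (-s)‖ ≤ Real.exp (π * |s.im|) * r ^ (-s.re) := by
  have hw : w ≠ 0 := norm_pos_iff.1 (hr.trans_le h)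
  rw [norm_cpow_of_ne_zero hw, div_eq_mul_inv, ← Real.exp_neg, mul_comm, neg_re, neg_im]
  refine mul_le_mul (Real.exp_le_exp.2 ?_) (Real.rpow_le_rpow_of_nonpos hr h (by linarith))
    (by positivity) (by positivity)
  have := abs_mul (arg w) s.im
  nlinarith [le_abs_self (arg w * s.im), abs_arg_le_pi w, abs_nonneg s.im]

lemma one_add_mul_mem_slitPlane {z : ℂ} (hz : z ∈ slitPlane) {x : ℝ} (hx : 0 ≤ x) :
    1 + x * z ∈ slitPlane := by
  rcases hz with h | h
  · left
    simp
    positivity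
  · rcases hx.eq_or_lt with rfl | hx
    · simp
    · right
      simp [h, hx.ne']

lemma mellin_one_add_cpow {s p : ℂ} (hp : 0 < p.re) (hps : p.re < s.re) :
    mellin (fun x : ℝ => (1 + (x : ℂ)) ^ (-s)) p =
      Complex.Gamma p * Complex.Gamma (s - p) / Complex.Gamma s := by
  have hb := betaIntegral_eq_Gamma_mul_div p (s - p) hp (by simpa using hps)
  rw [add_sub_cancel] at hb
  rw [← hb, betaIntegral, intervalIntegral.integral_of_le zero_le_one,
    integral_Ioc_eq_integral_Ioo]
  have him : (fun x : ℝ => x / (1 + x)) '' Set.Ioi 0 = Set.Ioo 0 1 := by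
    ext y
    constructor
    · rintro ⟨x, hx, rfl⟩
      have hx : (0 : ℝ) < x := hx
      exact ⟨by positivity, (div_lt_one (by positivity)).2 (by linarith)⟩
    · rintro ⟨h0, h1⟩
      refine ⟨y / (1 - y), div_pos h0 (by linarith), ?_⟩
      have : 1 - y ≠ 0 := by linarith
      field_simp
      ring
  have hinj : Set.InjOn (fun x : ℝ => x / (1 + x)) (Set.Ioi 0) := by
    intro x hx y hy h
    have hx : (0 : ℝ) < x := hx
    have hy : (0 : ℝ) < y := hy
    simp only at h
    rw [div_eq_div_iff (by positivity) (by positivity)] at h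
    linarith
  rw [← him, integral_image_eq_integral_abs_deriv_smul (f' := fun x => 1 / (1 + x) ^ 2)
    measurableSet_Ioi _ hinj]
  · refine setIntegral_congr_fun measurableSet_Ioi fun x hx => ?_
    have hx : (0 : ℝ) < x := hx
    have h1 : (0 : ℝ) < 1 + x := by positivity
    have h1' : ((1 : ℂ) + x) ≠ 0 := by exact_mod_cast h1.ne'
    have e1 : (1 : ℂ) - ((x / (1 + x) : ℝ) : ℂ) = ((1 + x : ℝ) : ℂ)⁻¹ := by
      push_cast
      field_simp
      ring
    simp only
    rw [e1, abs_of_pos (by positivity), ofReal_div, div_cpow_ofReal_nonneg hx.le h1.le,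
      inv_cpow_ofReal_nonneg h1.le, real_smul, smul_eq_mul]
    have e2 : ((1 : ℂ) + x) ^ (-s) = (((1 + x : ℝ) : ℂ) ^ (p - 1))⁻¹ *
        (((1 + x : ℝ) : ℂ) ^ (s - p - 1))⁻¹ * (((1 + x : ℝ) : ℂ) ^ (2 : ℂ))⁻¹ := by
      rw [← cpow_neg, ← cpow_neg, ← cpow_neg, ← cpow_add, ← cpow_add]
      · push_cast
        congr 1
        ring
      all_goals exact_mod_cast h1.ne'
    rw [e2]
    push_cast
    rw [cpow_ofNat]
    field_simp
  · intro x hx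
    have hx : (0 : ℝ) < x := hx
    have h1 : (1 + x) ≠ 0 := by positivity
    have := ((hasDerivAt_id x).div ((hasDerivAt_id x).const_add 1) h1)
    simp only [id] at this
    convert! this.hasDerivWithinAt using 1
    field_simp
    ring

lemma exists_norm_one_add_mul_cpow_le {z : ℂ} (hz : z ∈ slitPlane) {s : ℂ} (hs : 0 ≤ s.re) :
    ∃ C, 0 ≤ C ∧ ∃ δ > 0, ∀ z' ∈ Metric.ball z δ, ∀ x : ℝ, 0 ≤ x →
      ‖(1 + x * z') ^ (-s)‖ ≤ C * (1 + x) ^ (-s.re) := by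
  obtain ⟨c, hc, h⟩ := exists_pos_mul_le_norm_one_add_mul hz
  refine ⟨Real.exp (π * |s.im|) * (c / 2) ^ (-s.re), by positivity, c / 2, by positivity,
    fun z' hz' x hx => ?_⟩
  have h1 : c / 2 * (1 + x) ≤ ‖1 + x * z'‖ := by
    have e : (1 : ℂ) + x * z = (1 + x * z') - x * (z' - z) := by ring
    have h2 := h x hx
    rw [e] at h2
    have h3 := h2.trans (norm_sub_le _ _)
    rw [norm_mul, norm_real, Real.norm_of_nonneg hx] at h3
    have h4 : ‖z' - z‖ < c / 2 := by simpa [dist_eq_norm] using hz'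
    nlinarith
  refine (norm_cpow_neg_le_of_le_norm (by positivity) h1 hs).trans_eq ?_
  rw [Real.mul_rpow (by positivity) (by positivity), mul_assoc]

lemma continuousOn_one_add_mul_cpow {z : ℂ} (hz : z ∈ slitPlane) (s : ℂ) :
    ContinuousOn (fun x : ℝ => (1 + (x : ℂ) * z) ^ s) (Set.Ici 0) :=
  ContinuousOn.cpow_const (by fun_prop) fun _ hx => one_add_mul_mem_slitPlane hz hx

lemma aestronglyMeasurable_mellin_one_add_mul_cpow {z : ℂ} (hz : z ∈ slitPlane) (s p : ℂ) :
    AEStronglyMeasurable (fun x : ℝ => (x : ℂ) ^ (p - 1) * (1 + (x : ℂ) * z) ^ s)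
      (volume.restrict (Set.Ioi 0)) := by
  refine ContinuousOn.aestronglyMeasurable (ContinuousOn.mul ?_
    ((continuousOn_one_add_mul_cpow hz s).mono Set.Ioi_subset_Ici_self)) measurableSet_Ioi
  exact ContinuousOn.cpow_const (by fun_prop) fun x hx => ofReal_mem_slitPlane.2 hx

lemma mellinConvergent_one_add_mul_cpow {z : ℂ} (hz : z ∈ slitPlane) {s p : ℂ}
    (hp : 0 < p.re) (hps : p.re < s.re) :
    MellinConvergent (fun x : ℝ => (1 + (x : ℂ) * z) ^ (-s)) p := by
  obtain ⟨C, -, δ, hδ, h⟩ := exists_norm_one_add_mul_cpow_le hz (hp.trans hps).le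
  refine ((integrableOn_rpow_mul_one_add_rpow hp hps).const_mul C).mono'
    (aestronglyMeasurable_mellin_one_add_mul_cpow hz _ _) ?_
  filter_upwards [ae_restrict_mem measurableSet_Ioi] with x hx
  have hx : (0 : ℝ) < x := hx
  rw [norm_smul, norm_cpow_eq_rpow_re_of_pos hx, sub_re, one_re]
  calc _ ≤ x ^ (p.re - 1) * (C * (1 + x) ^ (-s.re)) :=
        mul_le_mul_of_nonneg_left (h z (Metric.mem_ball_self hδ) x hx.le) (by positivity)
    _ = _ := by ring

lemma exists_norm_mellin_one_add_mul_cpow_le (z s : ℂ) (σ : ℝ) :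
    ∃ C, ∀ p : ℂ, p.re = σ → ‖mellin (fun x : ℝ => (1 + (x : ℂ) * z) ^ (-s)) p‖ ≤ C := by
  refine ⟨∫ x in Set.Ioi (0 : ℝ), ‖(x : ℂ) ^ ((σ : ℂ) - 1) • (1 + (x : ℂ) * z) ^ (-s)‖,
    fun p hp => (norm_integral_le_integral_norm _).trans_eq ?_⟩
  refine setIntegral_congr_fun measurableSet_Ioi fun x hx => ?_
  have hx : (0 : ℝ) < x := hx
  simp only [norm_smul, norm_cpow_eq_rpow_re_of_pos hx, sub_re, one_re, hp, ofReal_re]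

lemma differentiableOn_mellin_one_add_mul_cpow {s p : ℂ} (hp : 0 < p.re) (hps : p.re < s.re) :
    DifferentiableOn ℂ (fun z : ℂ => mellin (fun x : ℝ => (1 + (x : ℂ) * z) ^ (-s)) p)
      slitPlane := by
  intro z hz
  have hs : 0 < s.re := hp.trans hps
  obtain ⟨C, hC, δ, hδ, h⟩ := exists_norm_one_add_mul_cpow_le hz (s := s + 1)
    (by simp; linarith)
  have hnhds : Metric.ball z δ ∩ slitPlane ∈ nhds z :=
    Filter.inter_mem (Metric.ball_mem_nhds z hδ) (isOpen_slitPlane.mem_nhds hz)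
  have := (hasDerivAt_integral_of_dominated_loc_of_deriv_le
    (μ := volume.restrict (Set.Ioi (0 : ℝ))) (s := Metric.ball z δ ∩ slitPlane)
    (F := fun z' (x : ℝ) => (x : ℂ) ^ (p - 1) • (1 + (x : ℂ) * z') ^ (-s))
    (F' := fun z' (x : ℝ) => (x : ℂ) ^ (p - 1) • (-s * (1 + (x : ℂ) * z') ^ (-s - 1) * x))
    (bound := fun x => ‖s‖ * C * (x ^ (p.re - 1) * (1 + x) ^ (-s.re))) (x₀ := z)
    hnhds ?_ (mellinConvergent_one_add_mul_cpow hz hp hps) ?_ ?_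
    ((integrableOn_rpow_mul_one_add_rpow hp hps).const_mul _) ?_).2
  · exact this.differentiableAt.differentiableWithinAt
  · filter_upwards [isOpen_slitPlane.mem_nhds hz] with z' hz'
    exact aestronglyMeasurable_mellin_one_add_mul_cpow hz' _ _
  · have h1 := (aestronglyMeasurable_mellin_one_add_mul_cpow hz (-s - 1) p)
    have h2 : AEStronglyMeasurable (fun x : ℝ => (-s * x : ℂ))
        (volume.restrict (Set.Ioi (0 : ℝ))) :=
      Continuous.aestronglyMeasurable (by fun_prop)
    refine (h1.mul h2).congr (Filter.Eventually.of_forall fun x => ?_)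
    simp only [Pi.mul_apply, smul_eq_mul]
    ring
  · filter_upwards [ae_restrict_mem measurableSet_Ioi] with x hx z' hz'
    have hx : (0 : ℝ) < x := hx
    have h1x : (0 : ℝ) < 1 + x := by positivity
    have hb := h z' hz'.1 x hx.le
    have e : (1 + x) ^ (-(s + 1).re) = (1 + x) ^ (-s.re) * (1 + x)⁻¹ := by
      rw [← Real.rpow_neg_one (1 + x), ← Real.rpow_add h1x]
      simp
      ring_nf
    rw [e, neg_add'] at hb
    rw [norm_smul, norm_cpow_eq_rpow_re_of_pos hx, sub_re, one_re, norm_mul, norm_mul, norm_neg,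
      norm_real, Real.norm_of_nonneg hx.le]
    have hq : x * (1 + x)⁻¹ ≤ 1 := by
      rw [← div_eq_mul_inv, div_le_one h1x]
      linarith
    calc _ ≤ x ^ (p.re - 1) * (‖s‖ * (C * ((1 + x) ^ (-s.re) * (1 + x)⁻¹)) * x) := by gcongr
      _ = ‖s‖ * C * (x ^ (p.re - 1) * (1 + x) ^ (-s.re)) * (x * (1 + x)⁻¹) := by ring
      _ ≤ _ := mul_le_of_le_one_right (by positivity) hq
  · filter_upwards [ae_restrict_mem measurableSet_Ioi] with x hx z' hz'
    have hx : (0 : ℝ) < x := hx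
    have hd : HasDerivAt (fun y : ℂ => 1 + (x : ℂ) * y) x z' := by
      simpa using ((hasDerivAt_id z').const_mul (x : ℂ)).const_add 1
    exact (hd.cpow_const (one_add_mul_mem_slitPlane hz'.2 hx.le)).const_mul ((x : ℂ) ^ (p - 1))

lemma mellin_one_add_mul_cpow {z : ℂ} (hz : z ∈ slitPlane) {s p : ℂ} (hp : 0 < p.re)
    (hps : p.re < s.re) :
    mellin (fun x : ℝ => (1 + (x : ℂ) * z) ^ (-s)) p =
      z ^ (-p) * (Complex.Gamma p * Complex.Gamma (s - p) / Complex.Gamma s) := by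
  have h1 := (differentiableOn_mellin_one_add_mul_cpow hp hps).analyticOnNhd isOpen_slitPlane
  have h2 : DifferentiableOn ℂ (fun z : ℂ =>
      z ^ (-p) * (Complex.Gamma p * Complex.Gamma (s - p) / Complex.Gamma s)) slitPlane :=
    (DifferentiableOn.cpow differentiableOn_id (differentiableOn_const _)
      fun z hz => hz).mul_const _
  refine h1.eqOn_of_preconnected_of_frequently_eq (h2.analyticOnNhd isOpen_slitPlane)
    (starConvex_one_slitPlane.isPathConnected one_mem_slitPlane).isConnected.isPreconnected
    one_mem_slitPlane ?_ hz
  have ht : Filter.Tendsto (fun t : ℝ => (t : ℂ)) (nhdsWithin 1 {1}ᶜ) (nhdsWithin 1 {1}ᶜ) := by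
    refine tendsto_nhdsWithin_iff.2 ⟨?_, ?_⟩
    · exact (by simpa using continuous_ofReal.tendsto (1 : ℝ) :
        Filter.Tendsto (fun t : ℝ => (t : ℂ)) (nhds 1) (nhds 1)).mono_left nhdsWithin_le_nhds
    · filter_upwards [self_mem_nhdsWithin] with t ht
      simpa using ht
  refine ht.frequently (Filter.Eventually.frequently ?_)
  filter_upwards [nhdsWithin_le_nhds (lt_mem_nhds (zero_lt_one (α := ℝ)))] with t ht
  rw [← mellin_one_add_cpow hp hps, ← smul_eq_mul, ← mellin_comp_mul_right _ _ ht]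
  simp

/-- The kernel `Γ(s+w)Γ(-w)/Γ(s)` of the Mellin–Barnes representation of `(1+z)^{-s}`. -/
def mellinBarnesKernel (s w : ℂ) : ℂ :=
  Complex.Gamma (s + w) * Complex.Gamma (-w) / Complex.Gamma s

lemma integrable_exp_neg_mul_abs {c : ℝ} (hc : 0 < c) :
    Integrable (fun v : ℝ => Real.exp (-(c * |v|))) := by
  rw [← integrableOn_univ, ← Set.Iic_union_Ioi (a := (0 : ℝ))]
  refine IntegrableOn.union ?_ ?_
  · refine (integrableOn_exp_mul_Iic hc 0).congr_fun (fun v hv => ?_) measurableSet_Iic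
    rw [abs_of_nonpos hv]
    ring_nf
  · refine (integrableOn_exp_mul_Ioi (neg_neg_of_pos hc) 0).congr_fun (fun v hv => ?_)
      measurableSet_Ioi
    rw [abs_of_pos hv]
    ring_nf

lemma norm_cpow_vertical {z : ℂ} (hz : z ≠ 0) (u v : ℝ) :
    ‖z ^ ((u : ℂ) + I * v)‖ = ‖z‖ ^ u * Real.exp (-(arg z * v)) := by
  rw [norm_cpow_of_ne_zero hz, div_eq_mul_inv, ← Real.exp_neg]
  simp

lemma cpow_mul_mellinBarnesKernel {z : ℂ} (hz : z ∈ slitPlane) {s : ℂ} {u : ℝ} (hu1 : -s.re < u)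
    (hu2 : u < 0) (v : ℝ) :
    z ^ ((u : ℂ) + I * v) * mellinBarnesKernel s (u + I * v) =
      mellin (fun x : ℝ => (1 + (x : ℂ) * z) ^ (-s)) (-(u + I * v)) := by
  rw [mellin_one_add_mul_cpow hz (by simpa using hu2) (by simp; linarith), neg_neg,
    mellinBarnesKernel, sub_neg_eq_add, mul_comm (Complex.Gamma (s + _))]

lemma exists_norm_mellinBarnesKernel_le {s : ℂ} {u : ℝ} (hu1 : -s.re < u) (hu2 : u < 0) {θ : ℝ}
    (h0 : 0 < θ) (hθ : θ < π) :
    ∃ C, ∀ v : ℝ, ‖mellinBarnesKernel s (u + I * v)‖ ≤ C * Real.exp (-(θ * |v|)) := by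
  have key : ∀ φ : ℝ, |φ| < π → ∃ C, ∀ v : ℝ,
      ‖mellinBarnesKernel s (u + I * v)‖ ≤ C * Real.exp (φ * v) := by
    intro φ hφ
    rw [abs_lt] at hφ
    have harg : arg (Complex.exp (φ * I)) = φ := arg_exp_mul_I φ ▸
      toIocMod_eq_self Real.two_pi_pos |>.2 ⟨hφ.1, by linarith⟩
    have hz : Complex.exp (φ * I) ∈ slitPlane := by
      rw [mem_slitPlane_iff_arg, harg]
      exact ⟨hφ.2.ne, exp_ne_zero _⟩
    obtain ⟨C, hC⟩ := exists_norm_mellin_one_add_mul_cpow_le (Complex.exp (φ * I)) s (-u)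
    refine ⟨C, fun v => ?_⟩
    have h := hC (-(u + I * v)) (by simp)
    rw [← cpow_mul_mellinBarnesKernel hz hu1 hu2, norm_mul, norm_cpow_vertical (exp_ne_zero _),
      harg, norm_exp_ofReal_mul_I, Real.one_rpow, one_mul, Real.exp_neg,
      inv_mul_le_iff₀ (by positivity)] at h
    linarith
  obtain ⟨C₁, h₁⟩ := key θ (by rwa [abs_of_pos h0])
  obtain ⟨C₂, h₂⟩ := key (-θ) (by rwa [abs_neg, abs_of_pos h0])
  refine ⟨max C₁ C₂, fun v => ?_⟩
  rcases le_total 0 v with hv | hv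
  · rw [abs_of_nonneg hv]
    refine (h₂ v).trans ?_
    rw [neg_mul]
    exact mul_le_mul_of_nonneg_right (le_max_right _ _) (by positivity)
  · rw [abs_of_nonpos hv]
    refine (h₁ v).trans ?_
    rw [mul_neg, neg_neg]
    exact mul_le_mul_of_nonneg_right (le_max_left _ _) (by positivity)

lemma continuous_mellinBarnesKernel {s : ℂ} {u : ℝ} (hu1 : -s.re < u) (hu2 : u < 0) :
    Continuous (fun v : ℝ => mellinBarnesKernel s (u + I * v)) := by
  have hG : ∀ (a b : ℂ), 0 < a.re → b.re = 0 →
      Continuous fun v : ℝ => Complex.Gamma (a + b * v) := by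
    intro a b ha hb
    refine continuous_iff_continuousAt.2 fun v => ?_
    refine ContinuousAt.comp (f := fun v : ℝ => a + b * v)
      (differentiableAt_Gamma _ fun m h => ?_).continuousAt (by fun_prop)
    have h2 := congrArg re h
    simp [hb] at h2
    have : (0 : ℝ) ≤ m := m.cast_nonneg
    linarith
  unfold mellinBarnesKernel
  refine Continuous.div_const (Continuous.mul ?_ ?_) _
  · convert! hG (s + u) I (by simp; linarith) (by simp) using 3
    ring
  · convert! hG (-u) (-I) (by simp; linarith) (by simp) using 3
    ring

lemma integrable_mellinBarnesKernel_mul_cpow {z : ℂ} (hz : z ∈ slitPlane) {s : ℂ} {u : ℝ}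
    (hu1 : -s.re < u) (hu2 : u < 0) :
    Integrable (fun v : ℝ => mellinBarnesKernel s (u + I * v) * z ^ ((u : ℂ) + I * v)) := by
  have hz0 := slitPlane_ne_zero hz
  have harg : |arg z| < π := (abs_arg_le_pi z).lt_of_ne fun h => by
    rcases eq_or_eq_neg_of_abs_eq h with h | h
    · exact (mem_slitPlane_iff_arg.1 hz).1 h
    · exact (neg_pi_lt_arg z).ne' h
  obtain ⟨C, hC⟩ := exists_norm_mellinBarnesKernel_le hu1 hu2 (θ := (|arg z| + π) / 2)
    (by positivity) (by linarith)
  refine ((integrable_exp_neg_mul_abs (c := (π - |arg z|) / 2) (by linarith)).const_mul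
    (C * ‖z‖ ^ u)).mono' ?_ (Filter.Eventually.of_forall fun v => ?_)
  · exact ((continuous_mellinBarnesKernel hu1 hu2).mul
      (Continuous.const_cpow (by fun_prop) (Or.inl hz0))).aestronglyMeasurable
  · have hC0 : 0 ≤ C := by simpa using (norm_nonneg _).trans (hC 0)
    rw [norm_mul, norm_cpow_vertical hz0]
    have h1 : Real.exp (-(arg z * v)) ≤ Real.exp (|arg z| * |v|) := by
      rw [← abs_mul]
      exact Real.exp_le_exp.2 (neg_le_abs _)
    calc _ ≤ (C * Real.exp (-((|arg z| + π) / 2 * |v|))) *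
          (‖z‖ ^ u * Real.exp (|arg z| * |v|)) := by
          gcongr
          exact hC v
      _ = C * ‖z‖ ^ u * (Real.exp (-((|arg z| + π) / 2 * |v|)) * Real.exp (|arg z| * |v|)) := by
          ring
      _ = _ := by
          rw [← Real.exp_add]
          ring_nf

/-- The Mellin–Barnes integral representation of `(1+z)^{-s}`. -/
lemma integral_mellinBarnesKernel_mul_cpow {z : ℂ} (hz : z ∈ slitPlane) {s : ℂ} {u : ℝ}
    (hu1 : -s.re < u) (hu2 : u < 0) :
    ∫ v : ℝ, mellinBarnesKernel s (u + I * v) * z ^ ((u : ℂ) + I * v) =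
      2 * π * (1 + z) ^ (-s) := by
  have e : ∀ y : ℝ, mellin (fun x : ℝ => (1 + (x : ℂ) * z) ^ (-s)) ((-u : ℝ) + y * I) =
      mellinBarnesKernel s (u + I * (-y : ℝ)) * z ^ ((u : ℂ) + I * (-y : ℝ)) := by
    intro y
    rw [mul_comm (mellinBarnesKernel _ _), cpow_mul_mellinBarnesKernel hz hu1 hu2]
    congr 1
    push_cast
    ring
  have hint := integrable_mellinBarnesKernel_mul_cpow hz hu1 hu2
  have h := mellinInv_mellin_eq (-u) (fun x : ℝ => (1 + (x : ℂ) * z) ^ (-s)) zero_lt_one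
    (mellinConvergent_one_add_mul_cpow hz (by simpa using hu2) (by simp; linarith)) ?_
    ((continuousOn_one_add_mul_cpow hz (-s)).continuousAt (Ici_mem_nhds zero_lt_one))
  · simp only [mellinInv, e, ofReal_one, one_cpow, one_smul, one_mul] at h
    rw [integral_neg_eq_self
      (fun v : ℝ => mellinBarnesKernel s (u + I * v) * z ^ ((u : ℂ) + I * v)) volume] at h
    rw [← h, real_smul]
    push_cast
    have : (π : ℂ) ≠ 0 := ofReal_ne_zero.2 Real.pi_ne_zero
    field_simp
  · simp only [VerticalIntegrable, e]
    exact hint.comp_neg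

lemma norm_ee_ofReal (x : ℝ) : ‖ee x‖ = 1 := by
  have : 2 * (π : ℂ) * I * x = ((2 * π * x : ℝ) : ℂ) * I := by
    push_cast
    ring
  rw [ee, this, norm_exp_ofReal_mul_I]

lemma ee_add (x y : ℂ) : ee (x + y) = ee x * ee y := by
  rw [ee, ee, ee, mul_add, Complex.exp_add]

/-- The general term of the Lerch zeta function `psiL r γ κ`. -/
def lerchTerm (r : ℂ) (γ κ : ℝ) (k : {k : ℤ // 0 < γ + (k : ℝ)}) : ℂ :=
  ee ((((γ + (k.1 : ℝ)) * κ : ℝ)) : ℂ) * (((γ + (k.1 : ℝ)) : ℝ) : ℂ) ^ (-r)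

lemma norm_lerchTerm (r : ℂ) (γ κ : ℝ) (k : {k : ℤ // 0 < γ + (k : ℝ)}) :
    ‖lerchTerm r γ κ k‖ = (γ + (k.1 : ℝ)) ^ (-r.re) := by
  rw [lerchTerm, norm_mul, norm_ee_ofReal, one_mul, norm_cpow_eq_rpow_re_of_pos k.2, neg_re]

lemma summable_add_int_rpow (γ : ℝ) {σ : ℝ} (hσ : 1 < σ) :
    Summable fun k : {k : ℤ // 0 < γ + (k : ℝ)} => (γ + (k.1 : ℝ)) ^ (-σ) := by
  refine (((Real.summable_one_div_int_add_rpow γ σ).2 hσ).subtype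
    {k : ℤ | 0 < γ + (k : ℝ)}).congr fun k => ?_
  have : 0 < γ + (k.1 : ℝ) := k.2
  simp only [Function.comp]
  rw [add_comm, abs_of_pos this, Real.rpow_neg this.le, one_div]

lemma summable_norm_lerchTerm {r : ℂ} (hr : 1 < r.re) (γ κ : ℝ) :
    Summable fun k => ‖lerchTerm r γ κ k‖ := by
  simp only [norm_lerchTerm]
  exact summable_add_int_rpow γ hr

lemma hasSum_lerchTerm {r : ℂ} (hr : 1 < r.re) (γ κ : ℝ) :
    HasSum (lerchTerm r γ κ) (psiL r γ κ) :=
  (summable_norm_lerchTerm hr γ κ).of_norm.hasSum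

lemma norm_psiL_le {r : ℂ} (hr : 1 < r.re) (γ κ : ℝ) :
    ‖psiL r γ κ‖ ≤ ∑' k : {k : ℤ // 0 < γ + (k : ℝ)}, (γ + (k.1 : ℝ)) ^ (-r.re) := by
  refine (norm_tsum_le_tsum_norm (summable_norm_lerchTerm hr γ κ)).trans_eq ?_
  exact tsum_congr fun k => norm_lerchTerm r γ κ k

lemma continuous_psiL_comp {σ : ℝ} (hσ : 1 < σ) (γ κ : ℝ) {f : ℝ → ℂ} (hf : Continuous f)
    (hre : ∀ v, (f v).re = σ) : Continuous fun v => psiL (f v) γ κ := by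
  refine continuous_tsum (u := fun k : {k : ℤ // 0 < γ + (k : ℝ)} => (γ + (k.1 : ℝ)) ^ (-σ))
    (fun k => ?_) (summable_add_int_rpow γ hσ) fun k v => ?_
  · exact continuous_const.mul (Continuous.const_cpow hf.neg
      (Or.inl (ofReal_ne_zero.2 k.2.ne')))
  · rw [← hre v]
    exact (norm_lerchTerm (f v) γ κ k).le

/-- The product of the Mellin–Barnes kernel, two Lerch zeta functions and a power of `z`,
on the line `Re w = u`. -/
def lerchIntegrand (s : ℂ) (γ κ δ' lam u : ℝ) (z : ℂ) (v : ℝ) : ℂ :=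
  mellinBarnesKernel s (u + I * v) * z ^ ((u : ℂ) + I * v) *
    (psiL (s + (u + I * v)) γ κ * psiL (-(u + I * v)) δ' lam)

lemma integrable_lerchIntegrand {s : ℂ} {u : ℝ} (hu1 : 1 - s.re < u) (hu2 : u < -1)
    (γ κ δ' lam : ℝ) {z : ℂ} (hz : z ∈ slitPlane) :
    Integrable (lerchIntegrand s γ κ δ' lam u z) := by
  have h1 : ∀ v : ℝ, (s + (u + I * v)).re = s.re + u := fun v => by simp
  have h2 : ∀ v : ℝ, (-((u : ℂ) + I * v)).re = -u := fun v => by simp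
  refine (integrable_mellinBarnesKernel_mul_cpow hz (by linarith) (by linarith)).mul_bdd
    (c := (∑' k : {k : ℤ // 0 < γ + (k : ℝ)}, (γ + (k.1 : ℝ)) ^ (-(s.re + u))) *
      ∑' k : {k : ℤ // 0 < δ' + (k : ℝ)}, (δ' + (k.1 : ℝ)) ^ (-(-u)))
    (Continuous.aestronglyMeasurable ?_) (Filter.Eventually.of_forall fun v => ?_)
  · exact (continuous_psiL_comp (by linarith) γ κ (by fun_prop) h1).mul
      (continuous_psiL_comp (by linarith) δ' lam (by fun_prop) h2)
  · rw [norm_mul]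
    have b1 := norm_psiL_le (r := s + (u + I * v)) (by rw [h1]; linarith) γ κ
    have b2 := norm_psiL_le (r := -((u : ℂ) + I * v)) (by rw [h2]; linarith) δ' lam
    rw [h1] at b1
    rw [h2] at b2
    exact mul_le_mul b1 b2 (norm_nonneg _) ((norm_nonneg _).trans b1)

lemma mul_cpow_ofReal_pos {a : ℝ} (ha : 0 < a) (z r : ℂ) :
    ((a : ℂ) * z) ^ r = (a : ℂ) ^ r * z ^ r := by
  rcases eq_or_ne z 0 with rfl | hz
  · rcases eq_or_ne r 0 with rfl | hr
    · simp
    · simp [hr]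
  · have ha' : (a : ℂ) ≠ 0 := ofReal_ne_zero.2 ha.ne'
    rw [cpow_def_of_ne_zero (mul_ne_zero ha' hz), cpow_def_of_ne_zero ha',
      cpow_def_of_ne_zero hz, log_ofReal_mul ha hz, ofReal_log ha.le, add_mul, Complex.exp_add]

lemma ofReal_mul_mem_slitPlane {a : ℝ} (ha : 0 < a) {z : ℂ} (hz : z ∈ slitPlane) :
    (a : ℂ) * z ∈ slitPlane := by
  rw [mem_slitPlane_iff_arg] at hz ⊢
  rw [arg_real_mul z ha]
  exact ⟨hz.1, mul_ne_zero (ofReal_ne_zero.2 ha.ne') hz.2⟩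

lemma hasSum_integral_lerchIntegrand {s : ℂ} {u : ℝ} (hu1 : 1 - s.re < u) (hu2 : u < -1)
    (γ κ δ' lam : ℝ) {z : ℂ} (hz : z ∈ slitPlane) :
    HasSum (fun p : {k : ℤ // 0 < γ + (k : ℝ)} × {l : ℤ // 0 < δ' + (l : ℝ)} =>
      ee ((((γ + (p.1.1 : ℝ)) * κ + (δ' + (p.2.1 : ℝ)) * lam : ℝ)) : ℂ) *
        ((((γ + (p.1.1 : ℝ)) : ℝ) : ℂ) + (((δ' + (p.2.1 : ℝ)) : ℝ) : ℂ) * z) ^ (-s))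
      (((1 / (2 * Real.pi) : ℝ) : ℂ) * ∫ v : ℝ, lerchIntegrand s γ κ δ' lam u z v) := by
  have h1 : ∀ v : ℝ, (s + (u + I * v)).re = s.re + u := fun v => by simp
  have h2 : ∀ v : ℝ, (-((u : ℂ) + I * v)).re = -u := fun v => by simp
  have hK := integrable_mellinBarnesKernel_mul_cpow hz (s := s) (u := u) (by linarith)
    (by linarith)
  let F : {k : ℤ // 0 < γ + (k : ℝ)} × {l : ℤ // 0 < δ' + (l : ℝ)} → ℝ → ℂ := fun p v =>
    mellinBarnesKernel s (u + I * v) * z ^ ((u : ℂ) + I * v) *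
      (lerchTerm (s + (u + I * v)) γ κ p.1 * lerchTerm (-(u + I * v)) δ' lam p.2)
  have hnorm : ∀ p v, ‖F p v‖ = ‖mellinBarnesKernel s (u + I * v) * z ^ ((u : ℂ) + I * v)‖ *
      ((γ + (p.1.1 : ℝ)) ^ (-(s.re + u)) * (δ' + (p.2.1 : ℝ)) ^ (-(-u))) := by
    intro p v
    rw [norm_mul, norm_mul (lerchTerm _ _ _ _), norm_lerchTerm, norm_lerchTerm, h1, h2]
  have hint : ∀ p, Integrable (F p) := by
    intro p
    refine hK.mul_bdd (c := (γ + (p.1.1 : ℝ)) ^ (-(s.re + u)) * (δ' + (p.2.1 : ℝ)) ^ (-(-u)))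
      (Continuous.aestronglyMeasurable ?_) (Filter.Eventually.of_forall fun v => ?_)
    · unfold lerchTerm
      refine (continuous_const.mul ?_).mul (continuous_const.mul ?_)
      · exact Continuous.const_cpow (by fun_prop) (Or.inl (ofReal_ne_zero.2 p.1.2.ne'))
      · exact Continuous.const_cpow (by fun_prop) (Or.inl (ofReal_ne_zero.2 p.2.2.ne'))
    · rw [norm_mul, norm_lerchTerm, norm_lerchTerm, h1, h2]
  have hval : ∀ p, ∫ v, F p v = 2 * π *
      (ee ((((γ + (p.1.1 : ℝ)) * κ + (δ' + (p.2.1 : ℝ)) * lam : ℝ)) : ℂ) *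
        ((((γ + (p.1.1 : ℝ)) : ℝ) : ℂ) + (((δ' + (p.2.1 : ℝ)) : ℝ) : ℂ) * z) ^ (-s)) := by
    rintro ⟨⟨k, hk⟩, ⟨l, hl⟩⟩
    simp only [F, lerchTerm]
    set A := γ + (k : ℝ)
    set B := δ' + (l : ℝ)
    have hA : (A : ℂ) ≠ 0 := ofReal_ne_zero.2 hk.ne'
    have hBA : 0 < B / A := div_pos hl hk
    have hpt : ∀ v : ℝ, mellinBarnesKernel s (u + I * v) * z ^ ((u : ℂ) + I * v) *
        (ee ((A * κ : ℝ) : ℂ) * (A : ℂ) ^ (-(s + (u + I * v))) *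
          (ee ((B * lam : ℝ) : ℂ) * (B : ℂ) ^ (-(-((u : ℂ) + I * v))))) =
        ee ((A * κ : ℝ) : ℂ) * ee ((B * lam : ℝ) : ℂ) * (A : ℂ) ^ (-s) *
          (mellinBarnesKernel s (u + I * v) * (((B / A : ℝ) : ℂ) * z) ^ ((u : ℂ) + I * v)) := by
      intro v
      rw [mul_cpow_ofReal_pos hBA, ofReal_div, div_cpow_ofReal_nonneg hl.le hk.le, neg_neg,
        neg_add, cpow_add _ _ hA, cpow_neg _ ((u : ℂ) + I * v)]
      ring
    simp_rw [hpt]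
    rw [integral_const_mul, integral_mellinBarnesKernel_mul_cpow (ofReal_mul_mem_slitPlane hBA hz)
      (by linarith) (by linarith)]
    have e : (A : ℂ) + B * z = (A : ℂ) * (1 + ((B / A : ℝ) : ℂ) * z) := by
      push_cast
      field_simp
    rw [e, mul_cpow_ofReal_pos hk, ofReal_add (A * κ), ee_add]
    ring
  have hsum : Summable fun p => ∫ v, ‖F p v‖ := by
    simp_rw [hnorm, integral_mul_const]
    exact ((summable_add_int_rpow γ (by linarith)).mul_of_nonneg
      (summable_add_int_rpow δ' (by linarith)) (fun k => Real.rpow_nonneg k.2.le _)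
      (fun l => Real.rpow_nonneg l.2.le _)).mul_left _
  have htsum : ∀ v, ∑' p, F p v = lerchIntegrand s γ κ δ' lam u z v := by
    intro v
    have hs1 := summable_norm_lerchTerm (r := s + (u + I * v)) (by rw [h1]; linarith) γ κ
    have hs2 := summable_norm_lerchTerm (r := -((u : ℂ) + I * v)) (by rw [h2]; linarith) δ' lam
    simp only [F]
    rw [tsum_mul_left, ← tsum_mul_tsum_of_summable_norm hs1 hs2]
    rfl
  have hmain := (hasSum_integral_of_summable_integral_norm hint hsum).mul_left
    (((1 / (2 * Real.pi) : ℝ) : ℂ))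
  simp_rw [htsum, hval] at hmain
  convert! hmain using 2 with p
  have : (π : ℂ) ≠ 0 := ofReal_ne_zero.2 Real.pi_ne_zero
  push_cast
  field_simp

/-- Multiplication by an integer `η` with `η² = 1`, as a permutation of `ℤ`. -/
def signPerm (η : ℤ) (h : η * η = 1) : ℤ ≃ ℤ where
  toFun k := η * k
  invFun k := η * k
  left_inv k := by
    simp only [← mul_assoc, h, one_mul]
  right_inv k := by
    simp only [← mul_assoc, h, one_mul]

lemma sign_mul_add {η : ℤ} (h : η * η = 1) (γ : ℝ) (k : ℤ) :
    (η : ℝ) * γ + k = η * (γ + ((η * k : ℤ) : ℝ)) := by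
  have h' : (η : ℝ) * η = 1 := by exact_mod_cast h
  push_cast
  linear_combination (-(k : ℝ)) * h'

/-- The substitution `k ↦ ηk`, where `η² = 1`, between index sets of sign-twisted series. -/
def signEquiv (η : ℤ) (h : η * η = 1) (γ : ℝ) :
    {k : ℤ // 0 < (η : ℝ) * γ + (k : ℝ)} ≃ {m : ℤ // 0 < (η : ℝ) * (γ + (m : ℝ))} :=
  (signPerm η h).subtypeEquiv fun k => by rw [sign_mul_add h]; rfl

/-- The general term of the generalized Eisenstein series. -/
def eisTerm (s : ℂ) (α β μ ν : ℝ) (z : ℂ) (p : ℤ × ℤ) : ℂ :=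
  ee ((((α + (p.1 : ℝ)) * μ + (β + (p.2 : ℝ)) * ν : ℝ)) : ℂ) *
    ((((α + (p.1 : ℝ)) : ℝ) : ℂ) + (((β + (p.2 : ℝ)) : ℝ) : ℂ) * z) ^ (-s)

lemma neg_cpow_of_sign {ε : ℤ} (hε : ε = 1 ∨ ε = -1) {y : ℂ} (hy : 0 < (ε : ℝ) * y.im) (r : ℂ) :
    (-y) ^ r = Complex.exp (-(ε : ℂ) * (π : ℂ) * I * r) * y ^ r := by
  have hy0 : y ≠ 0 := by
    rintro rfl
    simp at hy
  rw [cpow_def_of_ne_zero (neg_ne_zero.2 hy0), cpow_def_of_ne_zero hy0, ← Complex.exp_add]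
  congr 1
  have harg : arg (-y) = arg y - ε * π := by
    rcases hε with rfl | rfl
    · rw [arg_neg_eq_arg_sub_pi_of_im_pos (by simpa using hy)]
      simp
    · rw [arg_neg_eq_arg_add_pi_of_im_neg (by simpa using hy)]
      simp
  rw [Complex.log, Complex.log, norm_neg, harg]
  push_cast
  ring

lemma exp_sign_half_pi {ε : ℤ} (hε : ε = 1 ∨ ε = -1) :
    Complex.exp ((ε : ℂ) * (π : ℂ) * I / 2) = ε * I := by
  rcases hε with rfl | rfl
  · have : ((1 : ℤ) : ℂ) * (π : ℂ) * I / 2 = π / 2 * I := by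
      push_cast
      ring
    rw [this, exp_pi_div_two_mul_I]
    simp
  · have : ((-1 : ℤ) : ℂ) * (π : ℂ) * I / 2 = -π / 2 * I := by
      push_cast
      ring
    rw [this, exp_neg_pi_div_two_mul_I]
    simp

section Half

variable {ε : ℤ} {τ : ℂ} {s : ℂ} {u : ℝ}

lemma sign_mul_im_pos (hε : ε = 1 ∨ ε = -1) (hτ : 0 < τ.re) :
    0 < (ε : ℝ) * ((ε : ℂ) * I * τ).im := by
  rcases hε with rfl | rfl <;> simpa using hτ

lemma mem_slitPlane_of_sign_mul_im_pos {y : ℂ} (hy : 0 < (ε : ℝ) * y.im) : y ∈ slitPlane := by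
  right
  intro h
  simp [h] at hy

lemma sigIntegrand_eq (hε : ε = 1 ∨ ε = -1) (hτ : 0 < τ.re) (α μ β ν v : ℝ) :
    sigIntegrand ε s α μ β ν u τ v =
      lerchIntegrand s α μ (ε * β) (ε * ν) u (ε * I * τ) v +
      Complex.exp (-(ε : ℂ) * (π : ℂ) * I * s) *
        lerchIntegrand s (-α) (-μ) (ε * β) (ε * ν) u (-(ε * I * τ)) v := by
  rw [sigIntegrand, lerchIntegrand, lerchIntegrand, psiZpm, exp_sign_half_pi hε,
    neg_cpow_of_sign hε (sign_mul_im_pos hε hτ), mul_add _ s, Complex.exp_add, mellinBarnesKernel]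
  ring

lemma integrable_sigIntegrand (hε : ε = 1 ∨ ε = -1) (hτ : 0 < τ.re) (hu1 : 1 - s.re < u)
    (hu2 : u < -1) (α μ β ν : ℝ) : Integrable (sigIntegrand ε s α μ β ν u τ) := by
  have hZ := sign_mul_im_pos hε hτ
  have hZ' : 0 < ((-ε : ℤ) : ℝ) * (-((ε : ℂ) * I * τ)).im := by simpa using hZ
  have h := (integrable_lerchIntegrand hu1 hu2 α μ (ε * β) (ε * ν)
    (mem_slitPlane_of_sign_mul_im_pos hZ)).add ((integrable_lerchIntegrand hu1 hu2 (-α) (-μ)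
      (ε * β) (ε * ν) (mem_slitPlane_of_sign_mul_im_pos hZ')).const_mul
        (Complex.exp (-(ε : ℂ) * (π : ℂ) * I * s)))
  exact h.congr (Filter.Eventually.of_forall fun v => (sigIntegrand_eq hε hτ α μ β ν v).symm)

lemma hasSum_quadrant {η ε : ℤ} (hη : η * η = 1) (hε : ε * ε = 1) {α β : ℝ} {f : ℤ × ℤ → ℂ}
    {a : ℂ}
    (h : HasSum (fun p : {k : ℤ // 0 < (η : ℝ) * α + (k : ℝ)} ×
      {l : ℤ // 0 < (ε : ℝ) * β + (l : ℝ)} => f (η * p.1.1, ε * p.2.1)) a) :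
    HasSum (f ∘ (↑) : {p : ℤ × ℤ | 0 < (η : ℝ) * (α + (p.1 : ℝ)) ∧
      0 < (ε : ℝ) * (β + (p.2 : ℝ))} → ℂ) a := by
  let e := ((signEquiv η hη α).prodCongr (signEquiv ε hε β)).trans
    (Equiv.subtypeProdEquivProd (p := fun m : ℤ => 0 < (η : ℝ) * (α + (m : ℝ)))
      (q := fun n : ℤ => 0 < (ε : ℝ) * (β + (n : ℝ)))).symm
  exact (e.hasSum_iff).1 h

lemma mul_self_of_sign (hε : ε = 1 ∨ ε = -1) : ε * ε = 1 := by
  rcases hε with rfl | rfl <;> rfl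

lemma hasSum_eisTerm_pos (hε : ε = 1 ∨ ε = -1) (hτ : 0 < τ.re) (hu1 : 1 - s.re < u)
    (hu2 : u < -1) (α μ β ν : ℝ) :
    HasSum (eisTerm s α β μ ν (I * τ) ∘ (↑) : {p : ℤ × ℤ | 0 < ((1 : ℤ) : ℝ) * (α + (p.1 : ℝ)) ∧
      0 < (ε : ℝ) * (β + (p.2 : ℝ))} → ℂ) (((1 / (2 * Real.pi) : ℝ) : ℂ) *
        ∫ v : ℝ, lerchIntegrand s α μ (ε * β) (ε * ν) u (ε * I * τ) v) := by
  have hεε := mul_self_of_sign hε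
  have hc : (ε : ℂ) * ε = 1 := by exact_mod_cast hεε
  refine hasSum_quadrant (by norm_num) hεε ?_
  have h := hasSum_integral_lerchIntegrand hu1 hu2 α μ (ε * β) (ε * ν)
    (mem_slitPlane_of_sign_mul_im_pos (sign_mul_im_pos hε hτ))
  have e1 : ((1 : ℤ) : ℝ) * α = α := by simp
  rw [e1]
  convert! h using 2 with p
  rw [eisTerm, sign_mul_add hεε]
  congr 2
  · push_cast
    linear_combination (-(β + ε * (p.2.1 : ℂ)) * ν) * hc
  · push_cast
    linear_combination (-(β + ε * (p.2.1 : ℂ)) * I * τ) * hc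

lemma hasSum_eisTerm_neg (hε : ε = 1 ∨ ε = -1) (hτ : 0 < τ.re) (hu1 : 1 - s.re < u)
    (hu2 : u < -1) (α μ β ν : ℝ) :
    HasSum (eisTerm s α β μ ν (I * τ) ∘ (↑) : {p : ℤ × ℤ | 0 < ((-1 : ℤ) : ℝ) * (α + (p.1 : ℝ)) ∧
      0 < (ε : ℝ) * (β + (p.2 : ℝ))} → ℂ) (Complex.exp (-(ε : ℂ) * (π : ℂ) * I * s) *
        (((1 / (2 * Real.pi) : ℝ) : ℂ) *
          ∫ v : ℝ, lerchIntegrand s (-α) (-μ) (ε * β) (ε * ν) u (-(ε * I * τ)) v)) := by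
  have hεε := mul_self_of_sign hε
  have hc : (ε : ℂ) * ε = 1 := by exact_mod_cast hεε
  refine hasSum_quadrant (by norm_num) hεε ?_
  have hZ := sign_mul_im_pos hε hτ
  have hZ' : 0 < ((-ε : ℤ) : ℝ) * (-((ε : ℂ) * I * τ)).im := by simpa using hZ
  have h := (hasSum_integral_lerchIntegrand hu1 hu2 (-α) (-μ) (ε * β) (ε * ν)
    (mem_slitPlane_of_sign_mul_im_pos hZ')).mul_left (Complex.exp (-(ε : ℂ) * (π : ℂ) * I * s))
  have e1 : ((-1 : ℤ) : ℝ) * α = -α := by simp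
  rw [e1]
  convert! h using 2 with p
  rw [eisTerm]
  have hB : 0 < ε * β + (p.2.1 : ℝ) := p.2.2
  have hε' : -ε = 1 ∨ -ε = -1 := by
    rcases hε with rfl | rfl <;> simp
  set Y : ℂ := (((-α + (p.1.1 : ℝ)) : ℝ) : ℂ) +
    (((ε * β + (p.2.1 : ℝ)) : ℝ) : ℂ) * -((ε : ℂ) * I * τ) with hYdef
  have hY : 0 < ((-ε : ℤ) : ℝ) * Y.im := by
    have : ((-ε : ℤ) : ℝ) * Y.im = (ε * β + (p.2.1 : ℝ)) * (ε * ((ε : ℂ) * I * τ).im) := by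
      rw [hYdef, add_im, im_ofReal_mul, ofReal_im, neg_im]
      push_cast
      ring
    rw [this]
    exact mul_pos hB hZ
  have hbase : (((α + (((-1 * p.1.1 : ℤ), (ε * p.2.1 : ℤ)).1 : ℝ) : ℝ) : ℂ) +
      ((β + (((-1 * p.1.1 : ℤ), (ε * p.2.1 : ℤ)).2 : ℝ) : ℝ) : ℂ) * (I * τ)) = -Y := by
    rw [hYdef]
    push_cast
    linear_combination (-β * (I * τ)) * hc
  rw [hbase, neg_cpow_of_sign hε' hY, mul_left_comm]
  congr 1
  · congr 1
    push_cast
    ring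
  · congr 2
    push_cast
    linear_combination (-β * ν : ℂ) * hc

lemma hasSum_eisTerm_zero (hε : ε = 1 ∨ ε = -1) (hs : 1 < s.re) (α μ β ν : ℝ) :
    HasSum (eisTerm s α β μ ν (I * τ) ∘ (↑) : {p : ℤ × ℤ | α + (p.1 : ℝ) = 0 ∧
      0 < (ε : ℝ) * (β + (p.2 : ℝ))} → ℂ)
      (dInt α * psiL s (ε * β) (ε * ν) * (ε * I * τ) ^ (-s)) := by
  have hεε := mul_self_of_sign hε
  have hc : (ε : ℂ) * ε = 1 := by exact_mod_cast hεε
  by_cases hα : ∃ n : ℤ, (n : ℝ) = α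
  · rw [dInt, if_pos hα, one_mul]
    obtain ⟨n, rfl⟩ := hα
    let e : {l : ℤ // 0 < (ε : ℝ) * (β + (l : ℝ))} ≃
        {p : ℤ × ℤ | (n : ℝ) + (p.1 : ℝ) = 0 ∧ 0 < (ε : ℝ) * (β + (p.2 : ℝ))} :=
      { toFun := fun l => ⟨(-n, l.1), by simp, l.2⟩
        invFun := fun p => ⟨p.1.2, p.2.2⟩
        left_inv := fun l => rfl
        right_inv := by
          rintro ⟨⟨a, b⟩, h1, h2⟩
          have : n + a = 0 := by exact_mod_cast h1
          simp only [Subtype.mk.injEq, Prod.mk.injEq, and_true]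
          omega }
    rw [← ((signEquiv ε hεε β).trans e).hasSum_iff]
    convert! (hasSum_lerchTerm hs (ε * β) (ε * ν)).mul_right ((ε * I * τ) ^ (-s)) using 2 with l
    have hl : eisTerm s n β μ ν (I * τ) (-n, ε * l.1) =
        lerchTerm s (ε * β) (ε * ν) l * (ε * I * τ) ^ (-s) := by
      rw [eisTerm, lerchTerm, mul_assoc, ← mul_cpow_ofReal_pos l.2]
      congr 2
      · push_cast
        linear_combination (-β * ν : ℂ) * hc
      · push_cast
        linear_combination (-β * (I * τ)) * hc
    exact hl
  · rw [dInt, if_neg hα, zero_mul, zero_mul]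
    have : IsEmpty {p : ℤ × ℤ | α + (p.1 : ℝ) = 0 ∧ 0 < (ε : ℝ) * (β + (p.2 : ℝ))} := by
      refine ⟨fun p => hα ⟨-p.1.1, ?_⟩⟩
      have := p.2.1
      push_cast
      linarith
    exact hasSum_empty

lemma hasSum_eisTerm_half (hε : ε = 1 ∨ ε = -1) (hτ : 0 < τ.re) (hu1 : 1 - s.re < u)
    (hu2 : u < -1) (α μ β ν : ℝ) :
    HasSum (eisTerm s α β μ ν (I * τ) ∘ (↑) : {p : ℤ × ℤ | 0 < (ε : ℝ) * (β + (p.2 : ℝ))} → ℂ)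
      (SigPM ε s α μ β ν u τ) := by
  have hZ := sign_mul_im_pos hε hτ
  have hZ' : 0 < ((-ε : ℤ) : ℝ) * (-((ε : ℂ) * I * τ)).im := by simpa using hZ
  have h := HasSum.add_disjoint (Set.disjoint_left.2 ?_)
    (HasSum.add_disjoint (Set.disjoint_left.2 ?_) (hasSum_eisTerm_pos hε hτ hu1 hu2 α μ β ν)
      (hasSum_eisTerm_neg hε hτ hu1 hu2 α μ β ν))
    (hasSum_eisTerm_zero (τ := τ) hε (s := s) (by linarith) α μ β ν)
  · have hset : {p : ℤ × ℤ | 0 < (ε : ℝ) * (β + (p.2 : ℝ))} =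
        {p : ℤ × ℤ | 0 < ((1 : ℤ) : ℝ) * (α + (p.1 : ℝ)) ∧ 0 < (ε : ℝ) * (β + (p.2 : ℝ))} ∪
        {p : ℤ × ℤ | 0 < ((-1 : ℤ) : ℝ) * (α + (p.1 : ℝ)) ∧ 0 < (ε : ℝ) * (β + (p.2 : ℝ))} ∪
        {p : ℤ × ℤ | α + (p.1 : ℝ) = 0 ∧ 0 < (ε : ℝ) * (β + (p.2 : ℝ))} := by
      ext p
      simp only [Set.mem_union, Set.mem_ofPred_eq, ← or_and_right]
      refine ⟨fun hp => ⟨?_, hp⟩, And.right⟩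
      rcases lt_trichotomy 0 (α + (p.1 : ℝ)) with h | h | h
      · exact Or.inl (Or.inl (by simpa using h))
      · exact Or.inr h.symm
      · exact Or.inl (Or.inr (by push_cast; linarith))
    rw [hset]
    convert! h using 1
    rw [SigPM, exp_sign_half_pi hε]
    simp_rw [sigIntegrand_eq hε hτ]
    rw [integral_add (integrable_lerchIntegrand hu1 hu2 α μ (ε * β) (ε * ν)
        (mem_slitPlane_of_sign_mul_im_pos hZ))
      ((integrable_lerchIntegrand hu1 hu2 (-α) (-μ) (ε * β) (ε * ν)
        (mem_slitPlane_of_sign_mul_im_pos hZ')).const_mul _), integral_const_mul]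
    ring
  · rintro p (⟨hp, -⟩ | ⟨hp, -⟩) ⟨hp0, -⟩ <;> rw [hp0, mul_zero] at hp <;> exact hp.false
  · rintro p ⟨hp, -⟩ ⟨hp', -⟩
    push_cast at hp hp'
    linarith

end Half

lemma psiL_neg_neg (s : ℂ) (α μ : ℝ) :
    psiL s (-α) (-μ) = ∑' m : {m : ℤ // α + (m : ℝ) < 0},
      ee ((((α + (m.1 : ℝ)) * μ : ℝ)) : ℂ) * ((|α + (m.1 : ℝ)| : ℝ) : ℂ) ^ (-s) := by
  let e : {k : ℤ // 0 < -α + (k : ℝ)} ≃ {m : ℤ // α + (m : ℝ) < 0} :=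
    (Equiv.neg ℤ).subtypeEquiv fun k => by
      rw [Equiv.neg_apply]
      push_cast
      constructor <;> intro h <;> linarith
  rw [psiL, ← e.tsum_eq]
  refine tsum_congr fun k => ?_
  have he : ((e k).1 : ℝ) = -(k.1 : ℝ) := by
    simp [e]
  have hk : 0 < -α + (k.1 : ℝ) := k.2
  rw [he, abs_of_neg (by linarith)]
  have h1 : (-α + (k.1 : ℝ)) * -μ = (α + -(k.1 : ℝ)) * μ := by ring
  have h2 : -α + (k.1 : ℝ) = -(α + -(k.1 : ℝ)) := by ring
  rw [h1, h2]

/-- Lemma 7 of the paper: the Mellin–Barnes integral representation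
`F_{ℤ²}(s;α,β;μ,ν;z) = δ(β) 𝒜(s,α,μ) + Σ₋(s;z) + Σ₊(s;z)` for `Re s > 2`, `z = iτ`,
together with the absolute convergence of the two vertical integrals. -/
theorem statement18 (α β μ ν : ℝ) (s : ℂ) (hs : 2 < s.re) (τ : ℂ) (hτ : 0 < τ.re)
    (u : ℝ) (hu1 : 1 - s.re < u) (hu2 : u < -1) :
    Integrable (fun v : ℝ => sigIntegrand 1 s α μ β ν u τ v) ∧
      Integrable (fun v : ℝ => sigIntegrand (-1) s α μ β ν u τ v) ∧
      Fz2 s α β μ ν (Complex.I * τ) =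
        dInt β * Acal s α μ + SigPM (-1) s α μ β ν u τ + SigPM 1 s α μ β ν u τ := by
  refine ⟨integrable_sigIntegrand (Or.inl rfl) hτ hu1 hu2 α μ β ν,
    integrable_sigIntegrand (Or.inr rfl) hτ hu1 hu2 α μ β ν, ?_⟩
  have h := HasSum.add_disjoint (Set.disjoint_left.2 ?_)
    (hasSum_eisTerm_half (ε := -1) (Or.inr rfl) hτ hu1 hu2 α μ β ν)
    (hasSum_eisTerm_half (ε := 1) (Or.inl rfl) hτ hu1 hu2 α μ β ν)
  · have hset : {p : ℤ × ℤ | 0 < ((-1 : ℤ) : ℝ) * (β + (p.2 : ℝ))} ∪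
        {p : ℤ × ℤ | 0 < ((1 : ℤ) : ℝ) * (β + (p.2 : ℝ))} =
        {p : ℤ × ℤ | β + (p.2 : ℝ) ≠ 0} := by
      ext p
      simp only [Set.mem_union, Set.mem_ofPred_eq, ne_iff_lt_or_gt, Int.cast_neg, Int.cast_one,
        neg_one_mul, one_mul, neg_pos]
    rw [hset] at h
    have hF : Fz2 s α β μ ν (I * τ) =
        (SigPM (-1) s α μ β ν u τ + SigPM 1 s α μ β ν u τ) + dInt β * Acal s α μ := by
      rw [Fz2, Acal, psiL_neg_neg, ← h.tsum_eq, psiL, add_comm (Complex.cos _ * _)]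
      rfl
    rw [hF]
    ring
  · intro p hp hp'
    simp only [Set.mem_ofPred_eq] at hp hp'
    push_cast at hp hp'
    linarith

end
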